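/- arXiv:2503.02214 — 3 statements merged into one kernel-verified Lean document; each statement's English description precedes it below -/
import Mathlib

section
/- Let N ≥ 1, let K ≥ 0 be an integer, and let B be an N×N Hermitian positive definite complex matrix. Then for every N×N Hermitian positive definite complex matrix M one has -(K+1)·Real.log(det M).re - (Tr(M⁻¹ B)).re ≤ -(K+1)·Real.log(det((K+1)⁻¹ • B)).re - N·(K+1), and equality holds when M = (K+1)⁻¹ • B. (That is, the M-step objective M ↦ -(K+1)·log det(M) - Tr(M⁻¹B) over positive definite matrices is maximized at M = B/(K+1).) -/
open Matrix ComplexOrder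

/-- For a Hermitian positive definite matrix, `log det P ≤ Tr P - n`. -/
theorem Matrix.PosDef.log_det_le_trace_sub_card {n : Type*} [Fintype n] [DecidableEq n]
    {P : Matrix n n ℂ} (hP : P.PosDef) :
    Real.log P.det.re ≤ P.trace.re - Fintype.card n := by
  have hdet : P.det.re = ∏ i, hP.1.eigenvalues i := by
    rw [hP.1.det_eq_prod_eigenvalues]
    exact_mod_cast Complex.ofReal_re (∏ i, hP.1.eigenvalues i)
  have htr : P.trace.re = ∑ i, hP.1.eigenvalues i := by
    rw [hP.1.trace_eq_sum_eigenvalues]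
    exact_mod_cast Complex.ofReal_re (∑ i, hP.1.eigenvalues i)
  rw [hdet, htr, Real.log_prod fun i _ => (hP.eigenvalues_pos i).ne']
  calc ∑ i, Real.log (hP.1.eigenvalues i) ≤ ∑ i, (hP.1.eigenvalues i - 1) :=
        Finset.sum_le_sum fun i _ => Real.log_le_sub_one_of_pos (hP.eigenvalues_pos i)
    _ = ∑ i, hP.1.eigenvalues i - Fintype.card n := by simp

open scoped MatrixOrder in
/-- Nonnegativity of Stein's loss: `log det A - log det M ≤ Tr (M⁻¹ A) - n`. -/
theorem Matrix.PosDef.log_det_sub_log_det_le {n : Type*} [Fintype n] [DecidableEq n]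
    {A M : Matrix n n ℂ} (hA : A.PosDef) (hM : M.PosDef) :
    Real.log A.det.re - Real.log M.det.re ≤ (M⁻¹ * A).trace.re - Fintype.card n := by
  obtain ⟨R, hR⟩ := CStarAlgebra.nonneg_iff_eq_star_mul_self.mp hM.inv.posSemidef.nonneg
  rw [star_eq_conjTranspose] at hR
  have hRu : IsUnit R := by
    have h := hM.inv.isUnit
    rw [isUnit_iff_isUnit_det, hR, det_mul] at h
    exact (isUnit_iff_isUnit_det R).mpr (isUnit_of_mul_isUnit_right h)
  have hP : (R * A * Rᴴ).PosDef :=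
    hA.mul_mul_conjTranspose_same (vecMul_injective_of_isUnit hRu)
  have htr : (R * A * Rᴴ).trace = (M⁻¹ * A).trace := by
    rw [hR, trace_mul_comm, Matrix.mul_assoc, ← Matrix.mul_assoc]
  have hdet : A.det = M.det * (R * A * Rᴴ).det := by
    have h : M.det * M⁻¹.det = 1 := by
      rw [← det_mul, mul_nonsing_inv M ((isUnit_iff_isUnit_det M).mp hM.isUnit), det_one]
    rw [hR, det_mul] at h
    rw [det_mul, det_mul]
    linear_combination (-A.det) * h
  obtain ⟨hMre, hMim⟩ := Complex.pos_iff.mp hM.det_pos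
  obtain ⟨hPre, -⟩ := Complex.pos_iff.mp hP.det_pos
  have hre : A.det.re = M.det.re * (R * A * Rᴴ).det.re := by
    rw [hdet, Complex.mul_re, ← hMim, zero_mul, sub_zero]
  have hlog := hP.log_det_le_trace_sub_card
  rw [htr] at hlog
  rw [hre, Real.log_mul hMre.ne' hPre.ne']
  linarith

/-- The M-step objective `M ↦ -(K+1)·log det M - Tr(M⁻¹ B)` over Hermitian positive
definite matrices is maximized at `M = B/(K+1)`. -/
theorem mstep_covariance_maximizer (N K : ℕ) (hN : 1 ≤ N)
    (B : Matrix (Fin N) (Fin N) ℂ) (hB : B.PosDef) :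
    (∀ M : Matrix (Fin N) (Fin N) ℂ, M.PosDef →
      -((K : ℝ) + 1) * Real.log M.det.re - (Matrix.trace (M⁻¹ * B)).re ≤
        -((K : ℝ) + 1) * Real.log ((((K : ℂ) + 1)⁻¹ • B).det.re) - (N : ℝ) * ((K : ℝ) + 1)) ∧
    -((K : ℝ) + 1) * Real.log ((((K : ℂ) + 1)⁻¹ • B).det.re) -
        (Matrix.trace ((((K : ℂ) + 1)⁻¹ • B)⁻¹ * B)).re =
      -((K : ℝ) + 1) * Real.log ((((K : ℂ) + 1)⁻¹ • B).det.re) - (N : ℝ) * ((K : ℝ) + 1) := by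
  have hK : (0 : ℝ) < (K : ℝ) + 1 := by positivity
  have hc : ((K : ℂ) + 1)⁻¹ = (((K : ℝ) + 1)⁻¹ : ℝ) := by push_cast; rfl
  have hA : (((K : ℂ) + 1)⁻¹ • B).PosDef := by
    rw [hc]
    exact hB.smul (Complex.zero_lt_real.mpr (inv_pos.mpr hK))
  refine ⟨fun M hM => ?_, ?_⟩
  · have h := hA.log_det_sub_log_det_le hM
    have htr : (M⁻¹ * (((K : ℂ) + 1)⁻¹ • B)).trace.re =
        ((K : ℝ) + 1)⁻¹ * (M⁻¹ * B).trace.re := by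
      rw [Matrix.mul_smul, trace_smul, hc, smul_eq_mul, Complex.re_ofReal_mul]
    rw [htr, Fintype.card_fin] at h
    have h' := mul_le_mul_of_nonneg_left h hK.le
    rw [mul_sub, mul_sub, mul_inv_cancel_left₀ hK.ne'] at h'
    linarith
  · have hK' : (K : ℂ) + 1 ≠ 0 := Nat.cast_add_one_ne_zero K
    have hBA : B = ((K : ℂ) + 1) • (((K : ℂ) + 1)⁻¹ • B) := (smul_inv_smul₀ hK' B).symm
    have htr : ((((K : ℂ) + 1)⁻¹ • B)⁻¹ * B).trace = (((K : ℝ) + 1) * N : ℝ) := by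
      conv_lhs => enter [1, 2]; rw [hBA]
      rw [Matrix.mul_smul, nonsing_inv_mul _ ((isUnit_iff_isUnit_det _).mp hA.isUnit),
        trace_smul, trace_one, Fintype.card_fin]
      simp
    rw [htr, Complex.ofReal_re, mul_comm (N : ℝ)]
end

section
/- Define, for z, v ∈ ℂ^N and N×N complex matrices A, M̂, the scalar T(z, A, M̂, v) = (z†A⁻¹v)(v†M̂⁻¹z)/(v†A⁻¹v) + (v†A⁻¹z)(z†M̂⁻¹v)/(v†A⁻¹v) - (v†A⁻¹z)(z†A⁻¹v)(v†M̂⁻¹v)/(v†A⁻¹v)². Then for every invertible N×N complex matrix P and every nonzero c ∈ ℂ, whenever A and M̂ are invertible and v†A⁻¹v ≠ 0, one has T(Pz, PAP†, PM̂P†, c·Pv) = T(z, A, M̂, v). In particular T is invariant under whitening by M^{-1/2} and under any unitary rotation of the whitened data. -/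
open Matrix

/-- The expanded decision statistic of the EM-BML detector. -/
noncomputable def decisionStatT {N : ℕ} (z : Fin N → ℂ) (A Mh : Matrix (Fin N) (Fin N) ℂ)
    (v : Fin N → ℂ) : ℂ :=
  (star z ⬝ᵥ A⁻¹.mulVec v) * (star v ⬝ᵥ Mh⁻¹.mulVec z) / (star v ⬝ᵥ A⁻¹.mulVec v) +
    (star v ⬝ᵥ A⁻¹.mulVec z) * (star z ⬝ᵥ Mh⁻¹.mulVec v) / (star v ⬝ᵥ A⁻¹.mulVec v) -
    (star v ⬝ᵥ A⁻¹.mulVec z) * (star z ⬝ᵥ A⁻¹.mulVec v) * (star v ⬝ᵥ Mh⁻¹.mulVec v) /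
      (star v ⬝ᵥ A⁻¹.mulVec v) ^ 2

/-- Sesquilinear forms `x† B⁻¹ y` are invariant under a congruence by an invertible matrix. -/
theorem star_mulVec_dotProduct_inv_congruence {n R : Type*} [Fintype n] [DecidableEq n]
    [CommRing R] [StarRing R] {P : Matrix n n R} (hP : IsUnit P) (B : Matrix n n R)
    (x y : n → R) :
    star (P *ᵥ x) ⬝ᵥ (P * B * Pᴴ)⁻¹ *ᵥ (P *ᵥ y) = star x ⬝ᵥ B⁻¹ *ᵥ y := by
  have hdet : IsUnit P.det := (Matrix.isUnit_iff_isUnit_det P).mp hP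
  have hdet' : IsUnit Pᴴ.det := by
    rw [Matrix.det_conjTranspose]
    exact hdet.star
  have hcancel : Pᴴ * ((P * B * Pᴴ)⁻¹ * P) = B⁻¹ := by
    rw [Matrix.mul_inv_rev, Matrix.mul_inv_rev, Matrix.mul_assoc, Matrix.mul_assoc,
      Matrix.nonsing_inv_mul P hdet, Matrix.mul_one, Matrix.mul_nonsing_inv_cancel_left _ _ hdet']
  rw [Matrix.star_mulVec, ← Matrix.dotProduct_mulVec, Matrix.mulVec_mulVec,
    Matrix.mulVec_mulVec, Matrix.mul_assoc, hcancel]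

/-- The decision statistic `T` is invariant under the congruence transformation
`z ↦ Pz`, `A ↦ PAP†`, `M̂ ↦ PM̂P†`, `v ↦ c·Pv`: in particular it is invariant under
whitening and under unitary rotations of the whitened data. -/
theorem decisionStatT_invariant (N : ℕ) (z v : Fin N → ℂ) (A Mh : Matrix (Fin N) (Fin N) ℂ)
    (P : Matrix (Fin N) (Fin N) ℂ) (hP : IsUnit P) (c : ℂ) (hc : c ≠ 0)
    (hA : IsUnit A) (hMh : IsUnit Mh) (hv : star v ⬝ᵥ A⁻¹.mulVec v ≠ 0) :
    decisionStatT (P.mulVec z) (P * A * Pᴴ) (P * Mh * Pᴴ) (c • P.mulVec v) =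
      decisionStatT z A Mh v := by
  have hc' : star c ≠ 0 := star_ne_zero.mpr hc
  simp only [decisionStatT, star_smul, Matrix.mulVec_smul, smul_dotProduct, dotProduct_smul,
    smul_eq_mul, star_mulVec_dotProduct_inv_congruence hP]
  field_simp
end

section
/- Fix an integer K ≥ 0 and a real r > 0, and define for z, v ∈ ℂ^N (v ≠ 0) and an N×N Hermitian positive definite matrix S: q₀ = 1/(1+r), q₁ = r/(1+r), A = q₀(zz†+S) + q₁S, α̂ = (v†A⁻¹z)/(v†A⁻¹v), M̂ = (K+1)⁻¹·[q₀(zz†+S) + q₁((z-α̂v)(z-α̂v)† + S)], and F(r, z, S, v) = r·Real.exp( (z†M̂⁻¹z - (z-α̂v)†M̂⁻¹(z-α̂v)).re ). Then for every invertible N×N complex matrix P and every nonzero c ∈ ℂ, F(r, Pz, PSP†, c·Pv) = F(r, z, S, v). -/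
open Matrix ComplexOrder

/-- One iteration of the EM update of the posterior-probability ratio of the EM-BML
detector, starting from the ratio `r = q₁/q₀`. -/
noncomputable def emRatioUpdate (N K : ℕ) (r : ℝ) (z : Fin N → ℂ)
    (S : Matrix (Fin N) (Fin N) ℂ) (v : Fin N → ℂ) : ℝ :=
  let q₀ : ℝ := 1 / (1 + r)
  let q₁ : ℝ := r / (1 + r)
  let A := (q₀ : ℂ) • (vecMulVec z (star z) + S) + (q₁ : ℂ) • S
  let αh := (star v ⬝ᵥ A⁻¹.mulVec z) / (star v ⬝ᵥ A⁻¹.mulVec v)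
  let Mh := ((K : ℂ) + 1)⁻¹ • ((q₀ : ℂ) • (vecMulVec z (star z) + S) +
    (q₁ : ℂ) • (vecMulVec (z - αh • v) (star (z - αh • v)) + S))
  r * Real.exp ((star z ⬝ᵥ Mh⁻¹.mulVec z -
    star (z - αh • v) ⬝ᵥ Mh⁻¹.mulVec (z - αh • v)).re)

theorem vecMulVec_mulVec_star {N : ℕ} (P : Matrix (Fin N) (Fin N) ℂ) (w : Fin N → ℂ) :
    vecMulVec (P *ᵥ w) (star (P *ᵥ w)) = P * vecMulVec w (star w) * Pᴴ := by
  rw [mul_vecMulVec, vecMulVec_mul, star_mulVec]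

theorem star_mulVec_dotProduct_inv_mulVec {N : ℕ} {P : Matrix (Fin N) (Fin N) ℂ}
    (hP : IsUnit P) (M : Matrix (Fin N) (Fin N) ℂ) (x y : Fin N → ℂ) :
    star (P *ᵥ x) ⬝ᵥ (P * M * Pᴴ)⁻¹ *ᵥ (P *ᵥ y) = star x ⬝ᵥ M⁻¹ *ᵥ y := by
  have hdet : IsUnit P.det := (isUnit_iff_isUnit_det P).mp hP
  have hdetH : IsUnit Pᴴ.det := by
    rw [det_conjTranspose]
    exact hdet.star
  have hmul : Pᴴ * (P * M * Pᴴ)⁻¹ * P = M⁻¹ := by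
    rw [Matrix.mul_inv_rev, Matrix.mul_inv_rev, mul_nonsing_inv_cancel_left _ _ hdetH,
      nonsing_inv_mul_cancel_right _ _ hdet]
  rw [star_mulVec, ← dotProduct_mulVec, mulVec_mulVec, mulVec_mulVec, hmul]

/-- The EM update of the posterior ratio is invariant under `z ↦ Pz`, `S ↦ PSP†`,
`v ↦ c·Pv` for any invertible `P` and nonzero `c`: the deterministic core of the CFAR
property (Proposition 1). -/
theorem emRatioUpdate_invariant (N K : ℕ) (r : ℝ) (hr : 0 < r) (z v : Fin N → ℂ)
    (hv : v ≠ 0) (S : Matrix (Fin N) (Fin N) ℂ) (hS : S.PosDef)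
    (P : Matrix (Fin N) (Fin N) ℂ) (hP : IsUnit P) (c : ℂ) (hc : c ≠ 0) :
    emRatioUpdate N K r (P.mulVec z) (P * S * Pᴴ) (c • P.mulVec v) =
      emRatioUpdate N K r z S v := by
  have hA (a b : ℂ) (X Y : Matrix (Fin N) (Fin N) ℂ) :
      a • (P * X * Pᴴ + P * S * Pᴴ) + b • (P * Y * Pᴴ) = P * (a • (X + S) + b • Y) * Pᴴ := by
    simp only [Matrix.mul_add, Matrix.add_mul, Matrix.mul_smul, Matrix.smul_mul, smul_add]
  have hα (M : Matrix (Fin N) (Fin N) ℂ) :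
      (star (c • P *ᵥ v) ⬝ᵥ (P * M * Pᴴ)⁻¹ *ᵥ (P *ᵥ z)) /
        (star (c • P *ᵥ v) ⬝ᵥ (P * M * Pᴴ)⁻¹ *ᵥ (c • P *ᵥ v)) * c =
      (star v ⬝ᵥ M⁻¹ *ᵥ z) / (star v ⬝ᵥ M⁻¹ *ᵥ v) := by
    have hc' : star c ≠ 0 := star_ne_zero.mpr hc
    simp only [star_smul, mulVec_smul, smul_dotProduct, dotProduct_smul,
      star_mulVec_dotProduct_inv_mulVec hP, smul_eq_mul]
    rw [mul_left_comm c, mul_div_mul_left _ _ hc', div_mul_eq_mul_div, mul_comm _ c,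
      mul_div_mul_left _ _ hc]
  have hM (k a b : ℂ) (X Y : Matrix (Fin N) (Fin N) ℂ) :
      k • (a • (P * X * Pᴴ + P * S * Pᴴ) + b • (P * Y * Pᴴ + P * S * Pᴴ)) =
        P * (k • (a • (X + S) + b • (Y + S))) * Pᴴ := by
    simp only [Matrix.mul_add, Matrix.add_mul, Matrix.mul_smul, Matrix.smul_mul, smul_add]
  simp only [emRatioUpdate, vecMulVec_mulVec_star, hA]
  simp only [smul_smul, hα]
  simp only [← mulVec_smul, ← mulVec_sub]
  simp only [vecMulVec_mulVec_star, hM, star_mulVec_dotProduct_inv_mulVec hP]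
end
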